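/- Let p > 1 and let v : (0,∞) → (0,∞) be continuously differentiable with v^{-1/(p-1)} integrable at infinity, and suppose the function v'/v is strictly decreasing on (0,∞). Define χ(t) = v(t)^{-1/(p-1)} / ∫_t^∞ v(s)^{-1/(p-1)} ds. Then χ is positive, satisfies the ODE χ' = χ (χ − (1/(p−1)) v'/v) on (0,∞), and χ'(t) ≠ 0 for every t > 0. -/

import Mathlib

open MeasureTheory

open Set Filter Topology

/-- Derivative of a tail integral `t ↦ ∫_t^∞ w` of a function continuous on `(0, ∞)`. -/
lemma hasDerivAt_setIntegral_Ioi {w : ℝ → ℝ} (hc : ContinuousOn w (Ioi 0))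
    (hint : ∀ t > (0 : ℝ), IntegrableOn w (Ioi t)) {t : ℝ} (ht : 0 < t) :
    HasDerivAt (fun u => ∫ s in Ioi u, w s) (-w t) t := by
  have hftc : HasDerivAt (fun u => ∫ s in t..u, w s) (w t) t :=
    intervalIntegral.integral_hasDerivAt_right IntervalIntegrable.refl
      (hc.stronglyMeasurableAtFilter isOpen_Ioi t ht) (hc.continuousAt (Ioi_mem_nhds ht))
  refine (hftc.const_sub (∫ s in Ioi t, w s)).congr_of_eventuallyEq ?_
  filter_upwards [Ioi_mem_nhds ht] with u hu
  rw [← intervalIntegral.integral_Ioi_sub_Ioi' (hint t ht) (hint u hu), sub_sub_cancel]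

lemma setIntegral_Ioi_pos {w : ℝ → ℝ} {t : ℝ} (hpos : ∀ s > t, 0 < w s)
    (hint : IntegrableOn w (Ioi t)) : 0 < ∫ s in Ioi t, w s := by
  rw [setIntegral_pos_iff_support_of_nonneg_ae
    (ae_restrict_of_forall_mem measurableSet_Ioi fun s hs => (hpos s hs).le) hint,
    inter_eq_right.2 (show Ioi t ⊆ Function.support w from fun s hs => (hpos s hs).ne')]
  simp

/-- A function that is eventually bounded below by a positive constant is not integrable
near infinity. -/
lemma not_integrableOn_Ioi_of_eventually_ge {w : ℝ → ℝ} {a δ : ℝ} (hδ : 0 < δ)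
    (h : ∀ᶠ s in atTop, δ ≤ w s) : ¬ IntegrableOn w (Ioi a) := by
  intro hint
  obtain ⟨b, hb⟩ := eventually_atTop.1 h
  have hconst : IntegrableOn (fun _ => δ) (Ioi (max a b)) := by
    refine Integrable.mono' (hint.mono_set (Ioi_subset_Ioi (le_max_left a b)))
      aestronglyMeasurable_const (ae_restrict_of_forall_mem measurableSet_Ioi fun s hs => ?_)
    rw [Real.norm_of_nonneg hδ.le]
    exact hb s ((le_max_right a b).trans hs.le)
  rw [integrableOn_const_iff (by simp)] at hconst
  simp [hδ.ne'] at hconst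

/-- If `w' = -g w` with `w` positive and integrable at infinity and `g` strictly decreasing, then
`w t < g t * ∫_t^∞ w`. -/
lemma lt_mul_setIntegral_Ioi_of_strictAntiOn {w g : ℝ → ℝ} (hpos : ∀ t > (0 : ℝ), 0 < w t)
    (hderiv : ∀ t > (0 : ℝ), HasDerivAt w (-(g t * w t)) t)
    (hint : ∀ t > (0 : ℝ), IntegrableOn w (Ioi t)) (hanti : StrictAntiOn g (Ioi 0))
    {t : ℝ} (ht : 0 < t) : w t < g t * ∫ s in Ioi t, w s := by
  by_contra! hle
  have hc : ContinuousOn w (Ioi 0) := fun s hs => (hderiv s hs).continuousAt.continuousWithinAt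
  set W : ℝ → ℝ := fun u => ∫ s in Ioi u, w s
  have hF : ∀ s > (0 : ℝ), HasDerivAt (fun u => w u - g t * W u) ((g t - g s) * w s) s := by
    intro s hs
    exact ((hderiv s hs).sub ((hasDerivAt_setIntegral_Ioi hc hint hs).const_mul (g t))).congr_deriv
      (by ring)
  have hmono : StrictMonoOn (fun u => w u - g t * W u) (Ici t) := by
    refine strictMonoOn_of_deriv_pos (convex_Ici t)
      (fun s hs => (hF s (ht.trans_le hs)).continuousAt.continuousWithinAt) fun s hs => ?_
    rw [interior_Ici] at hs
    have hs0 : 0 < s := ht.trans hs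
    rw [(hF s hs0).deriv]
    exact mul_pos (sub_pos.2 (hanti ht hs0 hs)) (hpos s hs0)
  set δ := w (t + 1) - g t * W (t + 1)
  have hδ : 0 < δ := by
    have := hmono self_mem_Ici (mem_Ici.2 (by linarith : t ≤ t + 1)) (by linarith)
    simp only at this
    linarith
  have hWlim : Tendsto (fun u => g t * W u) atTop (𝓝 0) := by
    simpa using (tendsto_integral_Ioi_zero (f := w) (μ := volume) tendsto_id).const_mul (g t)
  refine not_integrableOn_Ioi_of_eventually_ge (half_pos hδ) ?_ (hint t ht)
  filter_upwards [hWlim.eventually (lt_mem_nhds (by linarith : -(δ / 2) < 0)),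
    eventually_ge_atTop (t + 1)] with s hs hts
  have := hmono.monotoneOn (mem_Ici.2 (by linarith : t ≤ t + 1))
    (mem_Ici.2 (by linarith : t ≤ s)) hts
  linarith

/-- ODE for χ = v^{-1/(p-1)} / ∫_t^∞ v^{-1/(p-1)} and non-vanishing of χ'. -/
theorem stmt_17 (p : ℝ) (hp : 1 < p) (v : ℝ → ℝ)
    (hv : ContDiffOn ℝ 1 v (Set.Ioi 0)) (hvpos : ∀ t > (0 : ℝ), 0 < v t)
    (hint : ∀ t > (0 : ℝ), IntegrableOn (fun s => v s ^ (-(1 / (p - 1)))) (Set.Ioi t))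
    (hanti : StrictAntiOn (fun t => deriv v t / v t) (Set.Ioi 0))
    (χ : ℝ → ℝ)
    (hχ : ∀ t, χ t = v t ^ (-(1 / (p - 1))) / ∫ s in Set.Ioi t, v s ^ (-(1 / (p - 1)))) :
    (∀ t > (0 : ℝ), 0 < χ t) ∧
    (∀ t > (0 : ℝ),
      HasDerivAt χ (χ t * (χ t - (1 / (p - 1)) * (deriv v t / v t))) t) ∧
    ∀ t > (0 : ℝ), deriv χ t ≠ 0 := by
  have ha : 0 < 1 / (p - 1) := one_div_pos.2 (sub_pos.2 hp)
  set a := 1 / (p - 1)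
  set w : ℝ → ℝ := fun s => v s ^ (-a) with hw_def
  have hw : ∀ t > (0 : ℝ), 0 < w t := fun t ht => Real.rpow_pos_of_pos (hvpos t ht) _
  have hwd : ∀ t > (0 : ℝ), HasDerivAt w (-(a * (deriv v t / v t) * w t)) t := by
    intro t ht
    have hd : HasDerivAt v (deriv v t) t :=
      ((hv.differentiableOn one_ne_zero).differentiableAt (Ioi_mem_nhds ht)).hasDerivAt
    have hvt := hvpos t ht
    convert hd.rpow_const (p := -a) (Or.inl hvt.ne') using 1
    rw [Real.rpow_sub_one hvt.ne']
    simp only [hw_def]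
    ring
  have hc : ContinuousOn w (Ioi 0) := fun s hs => (hwd s hs).continuousAt.continuousWithinAt
  have hW : ∀ t > (0 : ℝ), 0 < ∫ s in Ioi t, w s := fun t ht =>
    setIntegral_Ioi_pos (fun s hs => hw s (ht.trans hs)) (hint t ht)
  have hpos : ∀ t > (0 : ℝ), 0 < χ t := fun t ht => hχ t ▸ div_pos (hw t ht) (hW t ht)
  have hode : ∀ t > (0 : ℝ), HasDerivAt χ (χ t * (χ t - a * (deriv v t / v t))) t := by
    intro t ht
    have hWt := (hW t ht).ne'
    rw [show χ = fun t => w t / ∫ s in Ioi t, w s from funext hχ]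
    refine ((hwd t ht).div (hasDerivAt_setIntegral_Ioi hc hint ht) hWt).congr_deriv ?_
    have := (hvpos t ht).ne'
    field_simp
    ring
  refine ⟨hpos, hode, fun t ht => ?_⟩
  rw [(hode t ht).deriv]
  have hlt : χ t < a * (deriv v t / v t) := by
    rw [hχ t, div_lt_iff₀ (hW t ht)]
    exact lt_mul_setIntegral_Ioi_of_strictAntiOn (g := fun t => a * (deriv v t / v t)) hw hwd hint
      (fun x hx y hy hxy => mul_lt_mul_of_pos_left (hanti hx hy hxy) ha) ht
  exact (mul_neg_of_pos_of_neg (hpos t ht) (sub_neg.2 hlt)).ne
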